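/- The set {x ∈ E^ω : (v, x) ∈ ℤ for all v ∈ Φ_re^ω} (the coweight lattice of the root system Φ_re^ω in E^ω) equals the set of ℤ-linear combinations of {π̄_S : S a ⟨ω⟩-orbit in Δ₀ with α₀ ∉ S}. -/

import Mathlib

open scoped RealInnerProductSpace

namespace Folding

variable {E : Type*} [NormedAddCommGroup E] [InnerProductSpace ℝ E]

/-- The coroot `α^∨ = 2α/(α,α)` of a nonzero vector `α`. -/
noncomputable def coroot (α : E) : E := (2 / ⟪α, α⟫) • α

/-- The reflection `s_α(x) = x - (α^∨, x) α`. -/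
noncomputable def reflVec (α x : E) : E := x - ⟪coroot α, x⟫ • α

/-- `Φ` is a (finite, not necessarily reduced) root system in `E`. -/
def IsRootSystem (Φ : Set E) : Prop :=
  Φ.Finite ∧ (0 : E) ∉ Φ ∧ Submodule.span ℝ Φ = ⊤ ∧
    (∀ α ∈ Φ, ∀ β ∈ Φ, reflVec α β ∈ Φ) ∧
    ∀ α ∈ Φ, ∀ β ∈ Φ, ∃ n : ℤ, ⟪coroot α, β⟫ = (n : ℝ)

/-- `Φ` is reduced: no root is half of another root. -/
def IsReducedRS (Φ : Set E) : Prop := ∀ α ∈ Φ, (2⁻¹ : ℝ) • α ∉ Φ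

/-- `Φ` is irreducible: nonempty and not a disjoint union of two nonempty
mutually orthogonal subsets. -/
def IsIrreducibleRS (Φ : Set E) : Prop :=
  Φ.Nonempty ∧
    ¬∃ Φ₁ Φ₂ : Set E, Φ₁.Nonempty ∧ Φ₂.Nonempty ∧ Φ₁ ∪ Φ₂ = Φ ∧ Disjoint Φ₁ Φ₂ ∧
      ∀ u ∈ Φ₁, ∀ v ∈ Φ₂, ⟪u, v⟫ = 0

/-- `Δ` is a basis (a set of simple roots) of the root system `Φ`:
it is a vector space basis of `E`, and every root is a linear combination of `Δ`
whose coefficients are all nonnegative integers or all nonpositive integers. -/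
def IsBaseRS (Φ : Set E) (Δ : Finset E) : Prop :=
  ↑Δ ⊆ Φ ∧ LinearIndependent ℝ (fun α : {x : E // x ∈ Δ} => (α : E)) ∧
    Submodule.span ℝ (Δ : Set E) = ⊤ ∧
    ∀ β ∈ Φ, ∃ c : E → ℤ, ((∀ α, 0 ≤ c α) ∨ (∀ α, c α ≤ 0)) ∧
      β = ∑ α ∈ Δ, (c α : ℝ) • α

/-- `ω` belongs to the Weyl group of `Φ`: it is a product of reflections in roots. -/
def InWeylGroup (Φ : Set E) (ω : E ≃ₗᵢ[ℝ] E) : Prop :=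
  ∃ l : List E, (∀ α ∈ l, α ∈ Φ) ∧ ∀ x : E, ω x = l.foldr reflVec x

/-- The average `x^ω = (1/o(ω)) Σ_{t=1}^{o(ω)} ω^t(x)`, where `o(ω)` is the order of `ω`. -/
noncomputable def avg (ω : E ≃ₗᵢ[ℝ] E) (x : E) : E :=
  (orderOf ω : ℝ)⁻¹ • ∑ t ∈ Finset.range (orderOf ω), (ω ^ (t + 1)) x

/-- The fixed-point set `E^ω`. -/
def fixedSet (ω : E ≃ₗᵢ[ℝ] E) : Set E := {x | ω x = x}

/-- The fixed-point subspace `E^ω`. -/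
def fixedSubmodule (ω : E ≃ₗᵢ[ℝ] E) : Submodule ℝ E :=
  LinearMap.ker ((ω.toLinearEquiv : E →ₗ[ℝ] E) - LinearMap.id)

/-- The folded root system `Φ_re^ω = {β^ω : β ∈ Φ, β^ω ≠ 0}`. -/
noncomputable def foldedRoots (Φ : Set E) (ω : E ≃ₗᵢ[ℝ] E) : Set E :=
  {v | v ≠ 0 ∧ ∃ β ∈ Φ, avg ω β = v}

/-- The `⟨ω⟩`-orbit `O(β) = {ω^t(β) : t ∈ ℤ}`. -/
def orbitOf (ω : E ≃ₗᵢ[ℝ] E) (β : E) : Set E := {γ | ∃ t : ℤ, (ω ^ t) β = γ}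

/-- `N(β) = {γ ∈ O(β) : γ ≠ ±β, (β,γ) ≠ 0}`. -/
def nbrOf (ω : E ≃ₗᵢ[ℝ] E) (β : E) : Set E :=
  {γ | γ ∈ orbitOf ω β ∧ γ ≠ β ∧ γ ≠ -β ∧ ⟪β, γ⟫ ≠ 0}


/-- `Δ^ω`: the averages of the simple roots whose `⟨ω⟩`-orbit avoids `α₀ = -htilde`. -/
noncomputable def simpleAvg (Δ : Finset E) (htilde : E) (ω : E ≃ₗᵢ[ℝ] E) : Set E :=
  {v | ∃ α ∈ (Δ : Set E), -htilde ∉ orbitOf ω α ∧ avg ω α = v}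

/-- `π̄_S = (Σ_{α ∈ S} ϖ_α^∨)^ω` for a subset `S` of `Δ₀`. -/
noncomputable def pibar (ω : E ≃ₗᵢ[ℝ] E) (ϖ : E → E) (S : Set E) : E :=
  avg ω (∑ᶠ γ ∈ S, ϖ γ)

end Folding


open Folding
open scoped Classical

namespace Folding

variable {E : Type*} [NormedAddCommGroup E] [InnerProductSpace ℝ E]

/-! ### Roots, coroots and the coroot lattice -/

/-- The coroot lattice `Q^∨` of `Φ`. -/
noncomputable def corootLattice (Φ : Set E) : AddSubgroup E := AddSubgroup.closure (coroot '' Φ)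

lemma IsRootSystem.ne_zero {Φ : Set E} (h : IsRootSystem Φ) {α : E} (hα : α ∈ Φ) : α ≠ 0 :=
  fun h0 => h.2.1 (h0 ▸ hα)

lemma inner_coroot_self {α : E} (h : α ≠ 0) : ⟪α, coroot α⟫ = 2 := by
  have : ⟪α, α⟫ ≠ 0 := inner_self_ne_zero.2 h
  rw [coroot, inner_smul_right]
  field_simp

lemma IsRootSystem.neg_mem {Φ : Set E} (h : IsRootSystem Φ) {α : E} (hα : α ∈ Φ) : -α ∈ Φ := by
  have h1 := h.2.2.2.1 α hα α hα
  rwa [reflVec, real_inner_comm, inner_coroot_self (h.ne_zero hα), two_smul,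
    sub_add_cancel_left] at h1

lemma inner_reflVec_reflVec {α : E} (h : α ≠ 0) (x y : E) :
    ⟪reflVec α x, reflVec α y⟫ = ⟪x, y⟫ := by
  have : ⟪α, α⟫ ≠ 0 := inner_self_ne_zero.2 h
  simp only [reflVec, coroot, inner_sub_left, inner_sub_right, inner_smul_left, inner_smul_right,
    RCLike.conj_to_real, real_inner_comm α x]
  field_simp
  ring

lemma coroot_reflVec {α : E} (h : α ≠ 0) (β : E) :
    coroot (reflVec α β) = coroot β - ⟪α, coroot β⟫ • coroot α := by
  have : ⟪α, α⟫ ≠ 0 := inner_self_ne_zero.2 h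
  rw [coroot, inner_reflVec_reflVec h, reflVec]
  simp only [coroot, inner_smul_left, inner_smul_right, RCLike.conj_to_real, smul_sub, smul_smul]
  congr 2
  ring

/-- A reflection moves a vector by a multiple of the coroot. -/
lemma reflVec_eq_sub_smul_coroot (α x : E) : reflVec α x = x - ⟪α, x⟫ • coroot α := by
  simp only [reflVec, coroot, inner_smul_left, RCLike.conj_to_real, smul_smul]
  congr 2
  ring

lemma coroot_neg (α : E) : coroot (-α) = -coroot α := by
  simp [coroot]

/-- Two coroots at an obtuse angle add up to a coroot or to zero. -/
lemma IsRootSystem.coroot_add_coroot {Φ : Set E} (h : IsRootSystem Φ) {α β : E} (hα : α ∈ Φ)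
    (hβ : β ∈ Φ) (hneg : ⟪α, coroot β⟫ < 0) :
    coroot α + coroot β = 0 ∨ coroot α + coroot β ∈ coroot '' Φ := by
  have hα0 := h.ne_zero hα
  have hβ0 := h.ne_zero hβ
  have hαα : 0 < ⟪α, α⟫ := real_inner_self_pos.2 hα0
  have hββ : 0 < ⟪β, β⟫ := real_inner_self_pos.2 hβ0
  obtain ⟨m, hm⟩ := h.2.2.2.2 β hβ α hα
  obtain ⟨n, hn⟩ := h.2.2.2.2 α hα β hβ
  rw [real_inner_comm] at hm hn
  by_cases h1 : m = -1
  · refine Or.inr ⟨reflVec α β, h.2.2.2.1 α hα β hβ, ?_⟩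
    rw [coroot_reflVec hα0, hm, h1]
    simp [add_comm]
  by_cases h2 : n = -1
  · refine Or.inr ⟨reflVec β α, h.2.2.2.1 β hβ α hα, ?_⟩
    rw [coroot_reflVec hβ0, hn, h2]
    simp
  left
  rw [coroot, inner_smul_right] at hm hn
  rw [real_inner_comm α β] at hn
  have hmneg : (m : ℝ) < 0 := by
    rwa [← hm, ← inner_smul_right]
  have hab : ⟪α, β⟫ < 0 := by
    rw [← hm] at hmneg
    exact neg_of_mul_neg_right hmneg (by positivity)
  have hnneg : (n : ℝ) < 0 := by
    rw [← hn]
    exact mul_neg_of_pos_of_neg (by positivity) hab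
  have hm2 : (m : ℝ) ≤ -2 := by
    have : m < 0 := by exact_mod_cast hmneg
    exact_mod_cast (by omega : m ≤ -2)
  have hn2 : (n : ℝ) ≤ -2 := by
    have : n < 0 := by exact_mod_cast hnneg
    exact_mod_cast (by omega : n ≤ -2)
  have hm3 : 2 * ⟪α, β⟫ ≤ -2 * ⟪β, β⟫ := by
    have : 2 * ⟪α, β⟫ = m * ⟪β, β⟫ := by rw [← hm]; field_simp
    nlinarith
  have hn3 : 2 * ⟪α, β⟫ ≤ -2 * ⟪α, α⟫ := by
    have : 2 * ⟪α, β⟫ = n * ⟪α, α⟫ := by rw [← hn]; field_simp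
    nlinarith
  have hsum : α + β = 0 := by
    have h0 : ⟪α + β, α + β⟫ ≤ 0 := by
      simp only [inner_add_left, inner_add_right, real_inner_comm α β]
      linarith
    exact inner_self_eq_zero.1 (le_antisymm h0 real_inner_self_nonneg)
  rw [eq_neg_of_add_eq_zero_left hsum, coroot_neg, neg_add_cancel]

lemma IsRootSystem.sum_eq_zero_of_inner_lt_two {Φ : Set E} (h : IsRootSystem Φ) (n : ℕ) :
    ∀ s : Multiset E, s.card = n → (∀ v ∈ s, v ∈ coroot '' Φ) →
      (∀ β ∈ Φ, ⟪β, s.sum⟫ < 2) → s.sum = 0 := by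
  induction n using Nat.strong_induction_on with
  | _ n ih =>
    intro s hs hsΦ hlt
    rcases s.empty_or_exists_mem with rfl | ⟨u, hu⟩
    · simp
    obtain ⟨t, rfl⟩ := Multiset.exists_cons_of_mem hu
    obtain ⟨α, hα, rfl⟩ := hsΦ u hu
    have hneg : ∃ v ∈ t, ⟪α, v⟫ < 0 := by
      by_contra! hcon
      have h1 := hlt α hα
      rw [Multiset.sum_cons, inner_add_right, inner_coroot_self (h.ne_zero hα)] at h1
      have h2 : 0 ≤ ⟪α, t.sum⟫ := by
        have h3 : ⟪α, t.sum⟫ = (t.map (fun v => ⟪α, v⟫)).sum :=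
          map_multiset_sum (innerₛₗ ℝ α) t
        rw [h3]
        exact Multiset.sum_nonneg (by simpa using hcon)
      linarith
    obtain ⟨v, hv, hαv⟩ := hneg
    obtain ⟨r, rfl⟩ := Multiset.exists_cons_of_mem hv
    obtain ⟨β, hβ, rfl⟩ := hsΦ v (by simp)
    simp only [Multiset.card_cons] at hs
    have hsum : (coroot α ::ₘ coroot β ::ₘ r).sum = (coroot α + coroot β) + r.sum := by
      simp [add_assoc]
    rw [hsum] at hlt ⊢
    rcases h.coroot_add_coroot hα hβ hαv with h0 | h0
    · rw [h0, zero_add] at hlt ⊢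
      exact ih r.card (by omega) r rfl (fun v hv => hsΦ v (by simp [hv])) hlt
    · rw [← Multiset.sum_cons] at hlt ⊢
      refine ih (r.card + 1) (by omega) _ (by simp) ?_ hlt
      intro v hv
      rcases Multiset.mem_cons.1 hv with rfl | hv
      · exact h0
      · exact hsΦ v (by simp [hv])

/-- An element of the coroot lattice pairing to less than `2` with every root vanishes. -/
lemma IsRootSystem.eq_zero_of_mem_corootLattice {Φ : Set E} (h : IsRootSystem Φ) {x : E}
    (hx : x ∈ corootLattice Φ) (hlt : ∀ β ∈ Φ, ⟪β, x⟫ < 2) : x = 0 := by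
  have hx' : x ∈ AddSubmonoid.closure (coroot '' Φ ∪ -(coroot '' Φ)) := by
    rw [← AddSubgroup.closure_toAddSubmonoid]
    exact hx
  obtain ⟨s, hs, rfl⟩ := AddSubmonoid.exists_multiset_of_mem_closure hx'
  refine h.sum_eq_zero_of_inner_lt_two _ s rfl (fun v hv => ?_) hlt
  rcases hs v hv with h1 | ⟨α, hα, hαv⟩
  · exact h1
  · exact ⟨-α, h.neg_mem hα, by rw [coroot_neg, hαv, neg_neg]⟩

/-- The coweight lattice `P^∨` of `Φ`. -/
def coweightLattice (Φ : Set E) : AddSubgroup E where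
  carrier := {x | ∀ β ∈ Φ, ∃ n : ℤ, ⟪β, x⟫ = n}
  zero_mem' := fun _ _ => ⟨0, by simp⟩
  add_mem' := fun hx hy β hβ => by
    obtain ⟨m, hm⟩ := hx β hβ
    obtain ⟨n, hn⟩ := hy β hβ
    exact ⟨m + n, by rw [inner_add_right, hm, hn]; push_cast; rfl⟩
  neg_mem' := fun hx β hβ => by
    obtain ⟨m, hm⟩ := hx β hβ
    exact ⟨-m, by rw [inner_neg_right, hm]; push_cast; rfl⟩

lemma mem_coweightLattice {Φ : Set E} {x : E} :
    x ∈ coweightLattice Φ ↔ ∀ β ∈ Φ, ∃ n : ℤ, ⟪β, x⟫ = n := Iff.rfl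

lemma IsRootSystem.corootLattice_le {Φ : Set E} (h : IsRootSystem Φ) :
    corootLattice Φ ≤ coweightLattice Φ := by
  refine (AddSubgroup.closure_le _).2 ?_
  rintro _ ⟨α, hα, rfl⟩ β hβ
  obtain ⟨n, hn⟩ := h.2.2.2.2 α hα β hβ
  exact ⟨n, by rw [real_inner_comm, hn]⟩

/-- The Weyl group acts trivially on the quotient `P^∨ / Q^∨`. -/
lemma InWeylGroup.sub_mem_corootLattice {Φ : Set E} (h : IsRootSystem Φ) {ω : E ≃ₗᵢ[ℝ] E}
    (hω : InWeylGroup Φ ω) {x : E} (hx : x ∈ coweightLattice Φ) :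
    ω x - x ∈ corootLattice Φ := by
  obtain ⟨l, hl, hlω⟩ := hω
  rw [hlω]
  clear hlω
  induction l with
  | nil => simp
  | cons α l ih =>
    have ih' := ih fun β hβ => hl β (List.mem_cons_of_mem _ hβ)
    have hα : α ∈ Φ := hl α (by simp)
    have hP : l.foldr reflVec x ∈ coweightLattice Φ := by
      simpa using add_mem (h.corootLattice_le ih') hx
    obtain ⟨n, hn⟩ := hP α hα
    rw [List.foldr_cons, reflVec_eq_sub_smul_coroot, hn, Int.cast_smul_eq_zsmul, sub_right_comm]
    exact sub_mem ih' (zsmul_mem (AddSubgroup.subset_closure (Set.mem_image_of_mem _ hα)) n)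

lemma InWeylGroup.mapsTo {Φ : Set E} (h : IsRootSystem Φ) {ω : E ≃ₗᵢ[ℝ] E}
    (hω : InWeylGroup Φ ω) : Set.MapsTo ω Φ Φ := by
  obtain ⟨l, hl, hlω⟩ := hω
  intro x hx
  rw [hlω]
  clear hlω
  induction l with
  | nil => simpa
  | cons α l ih =>
    exact h.2.2.2.1 α (hl α (by simp)) _ (ih fun β hβ => hl β (List.mem_cons_of_mem _ hβ))

/-! ### Symmetries of an extended basis -/

/-- `ϖ` is dual to the extended basis `D` with special element `a`, where `m` are the
coefficients of the linear relation satisfied by `D`. -/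
structure IsExtendedDual (D : Finset E) (a : E) (ϖ : E → E) (m : E → ℝ) : Prop where
  mem : a ∈ D
  inner_eq : ∀ β ∈ D, ∀ γ ∈ D,
    ⟪β, ϖ γ⟫ = (if β = γ then 1 else 0) - m γ * (if β = a then 1 else 0)
  relation : ∑ γ ∈ D, m γ • γ = 0
  span_eq : Submodule.span ℝ (D : Set E) = ⊤
  sum_pos : 0 < ∑ γ ∈ D, m γ

lemma eq_of_forall_inner_eq {D : Set E} (hD : Submodule.span ℝ D = ⊤) {x y : E}
    (h : ∀ δ ∈ D, ⟪δ, x⟫ = ⟪δ, y⟫) : x = y := by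
  refine ext_inner_left ℝ fun v => ?_
  have hv : v ∈ Submodule.span ℝ D := hD ▸ Submodule.mem_top
  induction hv using Submodule.span_induction with
  | mem v hv => exact h v hv
  | zero => simp
  | add u v _ _ hu hv => rw [inner_add_left, inner_add_left, hu, hv]
  | smul c v _ hv => rw [inner_smul_left, inner_smul_left, hv]

lemma sum_apply_eq_sum {M : Type*} [AddCommMonoid M] (η : E ≃ₗᵢ[ℝ] E) {F : Finset E}
    (h : η '' F = F) (f : E → M) : ∑ γ ∈ F, f (η γ) = ∑ γ ∈ F, f γ := by
  have hF : F.image η = F := by exact_mod_cast h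
  conv_rhs => rw [← hF]
  rw [Finset.sum_image η.injective.injOn]

namespace IsExtendedDual

variable {D : Finset E} {a : E} {ϖ : E → E} {m : E → ℝ} {η : E ≃ₗᵢ[ℝ] E}

lemma apply_mem_iff (hη : η '' D = D) {γ : E} : η γ ∈ D ↔ γ ∈ D := by
  rw [← Finset.mem_coe, ← Finset.mem_coe]
  conv_lhs => rw [← hη]
  exact η.injective.mem_set_image

lemma eq_of_inner_apply (h : IsExtendedDual D a ϖ m) (hη : η '' D = D) {x y : E}
    (hxy : ∀ δ ∈ D, ⟪η δ, x⟫ = ⟪η δ, y⟫) : x = y := by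
  refine eq_of_forall_inner_eq h.span_eq fun δ hδ => ?_
  rw [← hη] at hδ
  obtain ⟨δ, hδ, rfl⟩ := hδ
  exact hxy δ hδ

lemma coeff_special (h : IsExtendedDual D a ϖ m) (h0 : ϖ a = 0) : m a = 1 := by
  have := h.inner_eq a h.mem a h.mem
  simp only [h0, inner_zero_right, if_true, mul_one] at this
  linarith

lemma coeff_apply (h : IsExtendedDual D a ϖ m) (hη : η '' D = D) {γ : E}
    (hγ : γ ∈ D) : m (η γ) = m γ := by
  have hrel : ∑ γ ∈ D, m (η γ) • γ = 0 := by
    apply η.injective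
    rw [map_sum, map_zero]
    simp only [map_smul]
    rw [sum_apply_eq_sum η hη (fun γ => m γ • γ), h.relation]
  have key : ∀ δ ∈ D, m (η δ) = m (η a) * m δ := by
    intro δ hδ
    have h1 : ⟪∑ γ ∈ D, m (η γ) • γ, ϖ δ⟫ = m (η δ) - m δ * m (η a) := by
      rw [sum_inner]
      calc ∑ γ ∈ D, ⟪m (η γ) • γ, ϖ δ⟫
          = ∑ γ ∈ D, ((if γ = δ then m (η γ) else 0) - m δ * (if γ = a then m (η γ) else 0)) := by
            refine Finset.sum_congr rfl fun γ hγ => ?_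
            rw [inner_smul_left, h.inner_eq γ hγ δ hδ, RCLike.conj_to_real]
            split_ifs <;> ring
        _ = m (η δ) - m δ * m (η a) := by
            rw [Finset.sum_sub_distrib, ← Finset.mul_sum]
            simp [hδ, h.mem]
    rw [hrel, inner_zero_left] at h1
    linarith
  have hsum : ∑ γ ∈ D, m γ = m (η a) * ∑ γ ∈ D, m γ := by
    rw [Finset.mul_sum, ← sum_apply_eq_sum η hη m]
    exact Finset.sum_congr rfl key
  have hone : m (η a) = 1 := by
    have := h.sum_pos
    nlinarith
  rw [key γ hγ, hone, one_mul]

lemma apply_dual (h : IsExtendedDual D a ϖ m) (hη : η '' D = D) (h0 : ϖ a = 0) {γ : E}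
    (hγ : γ ∈ D) : ϖ (η γ) = η (ϖ γ) + m γ • ϖ (η a) := by
  refine h.eq_of_inner_apply hη fun δ hδ => ?_
  rw [inner_add_right, inner_smul_right, η.inner_map_map,
    h.inner_eq _ ((apply_mem_iff hη).2 hδ) _ ((apply_mem_iff hη).2 hγ),
    h.inner_eq _ ((apply_mem_iff hη).2 hδ) _ ((apply_mem_iff hη).2 h.mem),
    h.inner_eq _ hδ _ hγ, h.coeff_apply hη hγ, h.coeff_apply hη h.mem,
    h.coeff_special h0]
  simp only [η.injective.eq_iff]
  ring

lemma sum_dual (h : IsExtendedDual D a ϖ m) {η : E ≃ₗᵢ[ℝ] E} (hη : η '' D = D) (h0 : ϖ a = 0)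
    {F : Finset E} (hFD : F ⊆ D) (hF : η '' F = F) :
    ∑ γ ∈ F, ϖ γ = η (∑ γ ∈ F, ϖ γ) + (∑ γ ∈ F, m γ) • ϖ (η a) := by
  rw [map_sum, Finset.sum_smul, ← Finset.sum_add_distrib, ← sum_apply_eq_sum η hF ϖ]
  exact Finset.sum_congr rfl fun γ hγ => h.apply_dual hη h0 (hFD hγ)

/-- The fundamental coweight `ϖ (η a)` of a special element `η a` is minuscule. -/
lemma inner_dual_lt_two (h : IsExtendedDual D a ϖ m) (hη : η '' D = D) (h0 : ϖ a = 0)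
    {Φ : Set E} (hηΦ : η '' Φ = Φ)
    (hheight : ∀ β ∈ Φ, |⟪β, ∑ γ ∈ D, ϖ γ⟫| < ∑ γ ∈ D, m γ) {β : E} (hβ : β ∈ Φ) :
    ⟪β, ϖ (η a)⟫ < 2 := by
  have h1 := h.sum_dual hη h0 subset_rfl hη
  obtain ⟨β', hβ', rfl⟩ : β ∈ η '' Φ := hηΦ.symm ▸ hβ
  have h2 := congrArg (fun x => ⟪η β', x⟫) h1
  simp only [inner_add_right, inner_smul_right, η.inner_map_map] at h2
  have h3 := abs_lt.1 (hheight _ hβ)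
  have h4 := abs_lt.1 (hheight _ hβ')
  have h5 := h.sum_pos
  nlinarith

end IsExtendedDual

/-! ### Powers, orbits and averages -/

lemma mul_apply_eq (f g : E ≃ₗᵢ[ℝ] E) (x : E) : (f * g) x = f (g x) := rfl

lemma coe_pow_eq_iterate (ω : E ≃ₗᵢ[ℝ] E) (n : ℕ) : ⇑(ω ^ n) = ω^[n] :=
  hom_coe_pow (fun f : E ≃ₗᵢ[ℝ] E => ⇑f) rfl (fun _ _ => rfl) ω n

/-- The linear isometries stabilizing a set. -/
def setStabilizer (X : Set E) : Subgroup (E ≃ₗᵢ[ℝ] E) where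
  carrier := {η | η '' X = X}
  one_mem' := by simp
  mul_mem' := fun {f g} hf hg => by
    simp only [Set.mem_ofPred_eq] at *
    rw [LinearIsometryEquiv.coe_mul, Set.image_comp, hg, hf]
  inv_mem' := fun {f} hf => by
    simp only [Set.mem_ofPred_eq] at *
    conv_lhs => rw [← hf]
    rw [← Set.image_comp, ← LinearIsometryEquiv.coe_mul, inv_mul_cancel]
    simp

lemma zpow_image_eq {ω : E ≃ₗᵢ[ℝ] E} {X : Set E} (h : ω '' X = X) (t : ℤ) :
    ⇑(ω ^ t) '' X = X :=
  (setStabilizer X).zpow_mem h t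

lemma pow_image_eq {ω : E ≃ₗᵢ[ℝ] E} {X : Set E} (h : ω '' X = X) (t : ℕ) :
    ⇑(ω ^ t) '' X = X :=
  (setStabilizer X).pow_mem h t

lemma zpow_apply_eq_self {ω : E ≃ₗᵢ[ℝ] E} {x : E} (h : ω x = x) (t : ℤ) : (ω ^ t) x = x := by
  have := zpow_image_eq (ω := ω) (X := {x}) (by simp [h]) t
  simpa using this

lemma pow_apply_eq_self {ω : E ≃ₗᵢ[ℝ] E} {x : E} (h : ω x = x) (t : ℕ) : (ω ^ t) x = x := by
  exact_mod_cast zpow_apply_eq_self h t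

/-- A linear isometry stabilizing a finite spanning set has finite order. -/
lemma isOfFinOrder_of_image_eq {ω : E ≃ₗᵢ[ℝ] E} {D : Finset E}
    (hD : Submodule.span ℝ (D : Set E) = ⊤) (h : ω '' D = D) : IsOfFinOrder ω := by
  by_contra hcon
  have hinj := injective_pow_iff_not_isOfFinOrder.2 hcon
  have hmem : ∀ (k : ℕ) (γ : D), (ω ^ k) γ ∈ D := fun k γ =>
    (IsExtendedDual.apply_mem_iff (pow_image_eq h k)).2 γ.2
  obtain ⟨i, j, hij, heq⟩ := Finite.exists_ne_map_eq_of_infinite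
    (fun (k : ℕ) (γ : D) => (⟨(ω ^ k) γ, hmem k γ⟩ : D))
  refine hij (hinj (LinearIsometryEquiv.toLinearEquiv_injective
    (LinearEquiv.toLinearMap_injective (LinearMap.ext_on hD fun γ hγ => ?_))))
  exact congrArg Subtype.val (congrFun heq ⟨γ, hγ⟩)

lemma self_mem_orbitOf (ω : E ≃ₗᵢ[ℝ] E) (β : E) : β ∈ orbitOf ω β := ⟨0, by simp⟩

lemma orbitOf_eq_of_mem {ω : E ≃ₗᵢ[ℝ] E} {β γ : E} (h : γ ∈ orbitOf ω β) :
    orbitOf ω γ = orbitOf ω β := by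
  obtain ⟨s, rfl⟩ := h
  ext δ
  constructor
  · rintro ⟨t, rfl⟩
    exact ⟨t + s, by rw [zpow_add, mul_apply_eq]⟩
  · rintro ⟨t, rfl⟩
    refine ⟨t - s, ?_⟩
    rw [← mul_apply_eq, ← zpow_add, sub_add_cancel]

lemma image_orbitOf (ω : E ≃ₗᵢ[ℝ] E) (β : E) : ω '' orbitOf ω β = orbitOf ω β := by
  ext γ
  constructor
  · rintro ⟨_, ⟨t, rfl⟩, rfl⟩
    exact ⟨1 + t, by rw [zpow_one_add, mul_apply_eq]⟩
  · rintro ⟨t, rfl⟩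
    refine ⟨(ω ^ (t - 1)) β, ⟨_, rfl⟩, ?_⟩
    rw [← mul_apply_eq, ← zpow_one_add, add_sub_cancel]

lemma orbitOf_subset {ω : E ≃ₗᵢ[ℝ] E} {X : Set E} (h : ω '' X = X) {β : E} (hβ : β ∈ X) :
    orbitOf ω β ⊆ X := by
  rintro _ ⟨t, rfl⟩
  rw [← zpow_image_eq h t]
  exact Set.mem_image_of_mem _ hβ

lemma apply_avg (ω : E ≃ₗᵢ[ℝ] E) (x : E) : ω (avg ω x) = avg ω x := by
  simp only [avg, map_smul, map_sum]
  congr 1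
  simp only [← mul_apply_eq, ← pow_succ']
  rw [← sub_eq_zero, ← Finset.sum_sub_distrib,
    Finset.sum_range_sub (fun t => (ω ^ (t + 1)) x)]
  simp [pow_succ, pow_orderOf_eq_one]

lemma avg_zpow_apply (ω : E ≃ₗᵢ[ℝ] E) (x : E) (t : ℤ) : avg ω ((ω ^ t) x) = avg ω x := by
  rw [← zpow_apply_eq_self (apply_avg ω x) t]
  simp only [avg, map_smul, map_sum]
  simp only [← mul_apply_eq, ← zpow_natCast, ← zpow_add, add_comm]

lemma inner_avg_eq_of_forall {ω : E ≃ₗᵢ[ℝ] E} (hω : IsOfFinOrder ω) {x y : E} {c : ℝ}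
    (h : ∀ t : ℕ, ⟪(ω ^ t) x, y⟫ = c) : ⟪avg ω x, y⟫ = c := by
  have : (orderOf ω : ℝ) ≠ 0 := by exact_mod_cast hω.orderOf_pos.ne'
  rw [avg, inner_smul_left, sum_inner]
  simp [h, this]

lemma inner_avg_left_of_fixed {ω : E ≃ₗᵢ[ℝ] E} (hω : IsOfFinOrder ω) {x y : E} (hy : ω y = y) :
    ⟪avg ω x, y⟫ = ⟪x, y⟫ := by
  refine inner_avg_eq_of_forall hω fun t => ?_
  conv_lhs => rw [← pow_apply_eq_self hy t]
  exact (ω ^ t).inner_map_map x y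

lemma inner_avg_comm {ω : E ≃ₗᵢ[ℝ] E} (hω : IsOfFinOrder ω) (x y : E) :
    ⟪avg ω x, y⟫ = ⟪x, avg ω y⟫ := by
  rw [← inner_avg_left_of_fixed hω (apply_avg ω y), real_inner_comm,
    ← inner_avg_left_of_fixed hω (apply_avg ω x), real_inner_comm]

namespace IsExtendedDual

variable {D : Finset E} {a : E} {ϖ : E → E} {m : E → ℝ} {ω : E ≃ₗᵢ[ℝ] E} {Φ : Set E}

/-- The class of `ϖ (ω ^ k a)` in `P^∨ / Q^∨` is `k` times that of `ϖ (ω a)`. -/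
lemma dual_pow_sub_nsmul_mem (h : IsExtendedDual D a ϖ m) (hω : ω '' D = D) (h0 : ϖ a = 0)
    (hP : ∀ γ ∈ D, ϖ γ ∈ coweightLattice Φ)
    (hW : ∀ x ∈ coweightLattice Φ, ω x - x ∈ corootLattice Φ) (k : ℕ) :
    ϖ ((ω ^ k) a) - k • ϖ (ω a) ∈ corootLattice Φ := by
  induction k with
  | zero => simp [h0]
  | succ k ih =>
    have hk := pow_image_eq hω k
    have hmem : (ω ^ k) a ∈ D := (apply_mem_iff hk).2 h.mem
    rw [pow_succ', mul_apply_eq, h.apply_dual hω h0 hmem,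
      h.coeff_apply hk h.mem, h.coeff_special h0, one_smul, succ_nsmul, add_sub_add_right_eq_sub]
    simpa using add_mem (hW _ (hP _ hmem)) ih

/-- The period of the special element divides the total coefficient of every stable set. -/
lemma minimalPeriod_dvd (h : IsExtendedDual D a ϖ m) (hω : ω '' D = D) (h0 : ϖ a = 0)
    (hΦ : IsRootSystem Φ) (hP : ∀ γ ∈ D, ϖ γ ∈ coweightLattice Φ)
    (hW : ∀ x ∈ coweightLattice Φ, ω x - x ∈ corootLattice Φ) (hωΦ : ω '' Φ = Φ)
    (hheight : ∀ β ∈ Φ, |⟪β, ∑ γ ∈ D, ϖ γ⟫| < ∑ γ ∈ D, m γ)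
    {F : Finset E} (hFD : F ⊆ D) (hF : ω '' F = F) {M : ℤ} (hM : ∑ γ ∈ F, m γ = M) :
    (Function.minimalPeriod ω a : ℤ) ∣ M := by
  have h1 : M • ϖ (ω a) ∈ corootLattice Φ := by
    have h2 := h.sum_dual hω h0 hFD hF
    rw [hM, Int.cast_smul_eq_zsmul] at h2
    have h3 := neg_mem (hW _ (sum_mem fun γ hγ => hP γ (hFD hγ) : ∑ γ ∈ F, ϖ γ ∈ _))
    rwa [neg_sub, sub_eq_of_eq_add' h2] at h3
  have h4 : M.natAbs • ϖ (ω a) ∈ corootLattice Φ := by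
    rw [← natCast_zsmul]
    rcases Int.natAbs_eq M with hM' | hM'
    · rwa [← hM']
    · rw [hM', neg_zsmul] at h1
      exact neg_mem_iff.1 h1
  have h5 : ϖ ((ω ^ M.natAbs) a) ∈ corootLattice Φ := by
    simpa using add_mem (h.dual_pow_sub_nsmul_mem hω h0 hP hW M.natAbs) h4
  have hk := pow_image_eq hω M.natAbs
  have h6 := hΦ.eq_zero_of_mem_corootLattice h5 fun β hβ =>
    h.inner_dual_lt_two hk h0 (pow_image_eq hωΦ _) hheight hβ
  have h7 : (ω ^ M.natAbs) a = a := by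
    have hmem := (apply_mem_iff hk).2 h.mem
    have h8 := h.inner_eq _ hmem _ hmem
    by_contra hne
    simp [h6, hne] at h8
  rw [coe_pow_eq_iterate] at h7
  exact Int.natCast_dvd.2 (Function.IsPeriodicPt.minimalPeriod_dvd h7)

lemma inner_sum_dual (h : IsExtendedDual D a ϖ m) {F : Finset E} (hFD : F ⊆ D) {β : E}
    (hβ : β ∈ D) : ⟪β, ∑ γ ∈ F, ϖ γ⟫ =
      (if β ∈ F then 1 else 0) - (∑ γ ∈ F, m γ) * (if β = a then 1 else 0) := by
  rw [inner_sum, Finset.sum_congr rfl fun γ hγ => h.inner_eq β hβ γ (hFD hγ),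
    Finset.sum_sub_distrib, Finset.sum_mul]
  simp

lemma inner_avg_special (h : IsExtendedDual D a ϖ m) (hω : ω '' D = D)
    {F : Finset E} (hFD : F ⊆ D) (hF : ω '' F = F) (haF : a ∉ F) :
    ⟪avg ω a, ∑ γ ∈ F, ϖ γ⟫ = -(∑ γ ∈ F, m γ) / Function.minimalPeriod ω a := by
  have hfin := isOfFinOrder_of_image_eq h.span_eq hω
  have hn : (orderOf ω : ℝ) ≠ 0 := by exact_mod_cast hfin.orderOf_pos.ne'
  have hdvd : Function.minimalPeriod ω a ∣ orderOf ω := by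
    apply Function.IsPeriodicPt.minimalPeriod_dvd
    rw [Function.IsPeriodicPt, ← coe_pow_eq_iterate, pow_orderOf_eq_one]
    rfl
  have hterm : ∀ t : ℕ, ⟪(ω ^ (t + 1)) a, ∑ γ ∈ F, ϖ γ⟫ =
      if Function.minimalPeriod ω a ∣ t + 1 then -(∑ γ ∈ F, m γ) else 0 := by
    intro t
    rw [h.inner_sum_dual hFD ((apply_mem_iff (pow_image_eq hω (t + 1))).2 h.mem),
      if_neg (mt (apply_mem_iff (pow_image_eq hF (t + 1))).1 haF), coe_pow_eq_iterate]
    simp only [← Function.isPeriodicPt_iff_minimalPeriod_dvd, Function.IsPeriodicPt,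
      Function.IsFixedPt]
    split_ifs <;> simp
  rw [avg, inner_smul_left, sum_inner, Finset.sum_congr rfl fun t _ => hterm t,
    ← Finset.sum_filter, Finset.sum_const, Nat.card_multiples, nsmul_eq_mul, Nat.cast_div hdvd]
  · rw [RCLike.conj_to_real]
    field_simp
  · intro h0
    have := zero_dvd_iff.1 ((Nat.cast_eq_zero.1 h0) ▸ hdvd)
    exact hn (by simp [this])

lemma exists_pibar_eq (hω : ω '' D = D) {α : E} (hα : α ∈ D) (haα : a ∉ orbitOf ω α) :
    ∃ F : Finset E, F ⊆ D ∧ ω '' F = F ∧ a ∉ F ∧ (F : Set E) = orbitOf ω α ∧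
      pibar ω ϖ (orbitOf ω α) = avg ω (∑ γ ∈ F, ϖ γ) := by
  have hsub : orbitOf ω α ⊆ D := orbitOf_subset hω hα
  obtain ⟨F, hF⟩ := (D.finite_toSet.subset hsub).exists_finset_coe
  refine ⟨F, ?_, ?_, ?_, hF, ?_⟩
  · rwa [← hF, Finset.coe_subset] at hsub
  · rw [hF, image_orbitOf]
  · rwa [← Finset.mem_coe, hF]
  · rw [pibar, ← hF, finsum_mem_coe_finset]

lemma inner_pibar (h : IsExtendedDual D a ϖ m) (hω : ω '' D = D) {α β : E} (hα : α ∈ D)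
    (haα : a ∉ orbitOf ω α) (hβ : β ∈ D) (haβ : a ∉ orbitOf ω β) :
    ⟪β, pibar ω ϖ (orbitOf ω α)⟫ = if β ∈ orbitOf ω α then 1 else 0 := by
  obtain ⟨F, hFD, hF, -, hFα, hpi⟩ := exists_pibar_eq (ϖ := ϖ) hω hα haα
  have hfin := isOfFinOrder_of_image_eq h.span_eq hω
  rw [hpi, ← inner_avg_comm hfin]
  refine inner_avg_eq_of_forall hfin fun t => ?_
  have hne : (ω ^ t) β ≠ a := fun ht => haβ ⟨t, by exact_mod_cast ht⟩
  rw [h.inner_sum_dual hFD ((apply_mem_iff (pow_image_eq hω t)).2 hβ), if_neg hne]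
  simp only [apply_mem_iff (pow_image_eq hF t), ← hFα, Finset.mem_coe]
  simp

/-- A fixed vector orthogonal to all orbits avoiding the special element vanishes. -/
lemma eq_zero_of_fixed (h : IsExtendedDual D a ϖ m) (hω : ω '' D = D) (h0 : ϖ a = 0) {z : E}
    (hz : ω z = z) (horth : ∀ β ∈ D, a ∉ orbitOf ω β → ⟪β, z⟫ = 0) : z = 0 := by
  have hval : ∀ β ∈ D, a ∈ orbitOf ω β → m β = 1 ∧ ⟪β, z⟫ = ⟪a, z⟫ := by
    rintro β hβ ⟨t, ht⟩
    constructor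
    · rw [← h.coeff_apply (zpow_image_eq hω t) hβ, ht, h.coeff_special h0]
    · conv_rhs => rw [← ht, ← zpow_apply_eq_self hz t]
      exact ((ω ^ t).inner_map_map β z).symm
  have hsum : ∑ β ∈ D, m β * ⟪β, z⟫ = 0 := by
    have := congrArg (fun v => ⟪v, z⟫) h.relation
    simpa [sum_inner, inner_smul_left] using this
  have hterm : ∀ β ∈ D, m β * ⟪β, z⟫ = if a ∈ orbitOf ω β then ⟪a, z⟫ else 0 := by
    intro β hβ
    split_ifs with hβa
    · rw [(hval β hβ hβa).1, (hval β hβ hβa).2, one_mul]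
    · rw [horth β hβ hβa, mul_zero]
  rw [Finset.sum_congr rfl hterm, ← Finset.sum_filter, Finset.sum_const, nsmul_eq_mul,
    mul_eq_zero, Nat.cast_eq_zero, Finset.card_eq_zero] at hsum
  have haz : ⟪a, z⟫ = 0 := hsum.resolve_left
    (Finset.ne_empty_of_mem (Finset.mem_filter.2 ⟨h.mem, self_mem_orbitOf ω a⟩))
  refine eq_of_forall_inner_eq h.span_eq fun β hβ => ?_
  rw [inner_zero_right]
  by_cases hβa : a ∈ orbitOf ω β
  · rw [(hval β hβ hβa).2, haz]
  · exact horth β hβ hβa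

/-- The `ω`-fixed coweights are spanned by the vectors `pibar` of orbits avoiding `a`. -/
lemma mem_span_pibar (h : IsExtendedDual D a ϖ m) (hω : ω '' D = D) (h0 : ϖ a = 0)
    (hDΦ : (D : Set E) ⊆ Φ) {x : E} (hx : ω x = x) (hxP : x ∈ coweightLattice Φ) :
    x ∈ Submodule.span ℤ {v : E | ∃ α ∈ (D : Set E),
      a ∉ orbitOf ω α ∧ v = pibar ω ϖ (orbitOf ω α)} := by
  have hex : ∀ S : Set E, ∃ n : ℤ, ∀ β ∈ D, orbitOf ω β = S → ⟪β, x⟫ = n := by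
    intro S
    by_cases hS : ∃ β ∈ D, orbitOf ω β = S
    · obtain ⟨β, hβ, rfl⟩ := hS
      obtain ⟨n, hn⟩ := hxP β (hDΦ hβ)
      refine ⟨n, fun γ _ hγ => ?_⟩
      obtain ⟨t, rfl⟩ : γ ∈ orbitOf ω β := hγ ▸ self_mem_orbitOf ω γ
      conv_lhs => rw [← zpow_apply_eq_self hx t]
      rw [(ω ^ t).inner_map_map, hn]
    · push Not at hS
      exact ⟨0, fun β hβ hβS => absurd hβS (hS β hβ)⟩
  choose n hn using hex
  set T : Finset (Set E) := (D.filter fun α => a ∉ orbitOf ω α).image (orbitOf ω) with hT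
  have hTmem : ∀ S ∈ T, ∃ α ∈ D, a ∉ orbitOf ω α ∧ orbitOf ω α = S := by
    intro S hS
    obtain ⟨α, hα, rfl⟩ := Finset.mem_image.1 hS
    exact ⟨α, (Finset.mem_filter.1 hα).1, (Finset.mem_filter.1 hα).2, rfl⟩
  have hxy : x = ∑ S ∈ T, n S • pibar ω ϖ S := by
    rw [← sub_eq_zero]
    refine h.eq_zero_of_fixed hω h0 ?_ fun β hβ haβ => ?_
    · rw [map_sub, map_sum, hx]
      congr 1
      refine Finset.sum_congr rfl fun S _ => ?_
      rw [map_zsmul, pibar, apply_avg]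
    · have hβT : orbitOf ω β ∈ T :=
        Finset.mem_image_of_mem _ (Finset.mem_filter.2 ⟨hβ, haβ⟩)
      have hterm : ∀ S ∈ T, ⟪β, n S • pibar ω ϖ S⟫ = if orbitOf ω β = S then (n S : ℝ) else 0 := by
        intro S hS
        obtain ⟨α, hα, haα, rfl⟩ := hTmem S hS
        have hiff : β ∈ orbitOf ω α ↔ orbitOf ω β = orbitOf ω α :=
          ⟨orbitOf_eq_of_mem, fun he => he ▸ self_mem_orbitOf ω β⟩
        rw [← Int.cast_smul_eq_zsmul ℝ, inner_smul_right, h.inner_pibar hω hα haα hβ haβ]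
        simp only [hiff, mul_ite, mul_one, mul_zero]
      rw [inner_sub_right, inner_sum, Finset.sum_congr rfl hterm, Finset.sum_ite_eq, if_pos hβT,
        hn _ β hβ rfl, sub_self]
  rw [hxy]
  refine Submodule.sum_mem _ fun S hS => Submodule.smul_mem _ _ (Submodule.subset_span ?_)
  obtain ⟨α, hα, haα, rfl⟩ := hTmem S hS
  exact ⟨α, hα, haα, rfl⟩

/-- The vector `pibar` of an orbit avoiding `a` pairs integrally with the extended basis. -/
lemma exists_inner_pibar_eq (h : IsExtendedDual D a ϖ m) (hω : ω '' D = D) (h0 : ϖ a = 0)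
    (hΦ : IsRootSystem Φ) (hP : ∀ γ ∈ D, ϖ γ ∈ coweightLattice Φ)
    (hW : ∀ x ∈ coweightLattice Φ, ω x - x ∈ corootLattice Φ) (hωΦ : ω '' Φ = Φ)
    (hheight : ∀ β ∈ Φ, |⟪β, ∑ γ ∈ D, ϖ γ⟫| < ∑ γ ∈ D, m γ) (haΦ : a ∈ Φ)
    {α β : E} (hα : α ∈ D) (haα : a ∉ orbitOf ω α) (hβ : β ∈ D) :
    ∃ n : ℤ, ⟪β, pibar ω ϖ (orbitOf ω α)⟫ = n := by
  by_cases haβ : a ∈ orbitOf ω β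
  · obtain ⟨F, hFD, hF, haF, -, hpi⟩ := exists_pibar_eq (ϖ := ϖ) hω hα haα
    have hfin := isOfFinOrder_of_image_eq h.span_eq hω
    obtain ⟨t, ht⟩ := haβ
    obtain ⟨M, hM⟩ : ∃ M : ℤ, ∑ γ ∈ F, m γ = M := by
      obtain ⟨M, hM⟩ := mem_coweightLattice.1 (sum_mem fun γ hγ => hP γ (hFD hγ)) a haΦ
      rw [h.inner_sum_dual hFD h.mem, if_neg haF, if_pos rfl] at hM
      exact ⟨-M, by push_cast; linarith⟩
    obtain ⟨k, hk⟩ := h.minimalPeriod_dvd hω h0 hΦ hP hW hωΦ hheight hFD hF hM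
    rw [hpi, ← inner_avg_comm hfin, ← avg_zpow_apply ω β t, ht,
      h.inner_avg_special hω hFD hF haF, hM, hk]
    by_cases hN : (Function.minimalPeriod ω a : ℝ) = 0
    · exact ⟨0, by simp [hN]⟩
    · refine ⟨-k, ?_⟩
      push_cast
      field_simp
  · rw [h.inner_pibar hω hα haα hβ haβ]
    split_ifs
    exacts [⟨1, by simp⟩, ⟨0, by simp⟩]

end IsExtendedDual

/-- The fixed vectors in the coweight lattice of the folded root system are the fixed coweights. -/
lemma forall_foldedRoots_iff {Φ : Set E} {ω : E ≃ₗᵢ[ℝ] E} (hfin : IsOfFinOrder ω) {x : E}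
    (hx : ω x = x) :
    (∀ v ∈ foldedRoots Φ ω, ∃ n : ℤ, ⟪v, x⟫ = n) ↔ x ∈ coweightLattice Φ := by
  constructor
  · intro h β hβ
    rw [← inner_avg_left_of_fixed hfin hx]
    by_cases h0 : avg ω β = 0
    · exact ⟨0, by simp [h0]⟩
    · exact h _ ⟨h0, β, hβ, rfl⟩
  · rintro h _ ⟨-, β, hβ, rfl⟩
    rw [inner_avg_left_of_fixed hfin hx]
    exact h β hβ

/-- A vector pairing integrally with a basis of `Φ` is a coweight. -/
lemma IsBaseRS.mem_coweightLattice {Φ : Set E} {Δ : Finset E} (h : IsBaseRS Φ Δ) {x : E}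
    (hx : ∀ α ∈ Δ, ∃ n : ℤ, ⟪α, x⟫ = n) : x ∈ coweightLattice Φ := by
  intro β hβ
  obtain ⟨c, -, hc⟩ := h.2.2.2 β hβ
  choose! n hn using hx
  refine ⟨∑ α ∈ Δ, c α * n α, ?_⟩
  rw [hc, sum_inner]
  push_cast
  refine Finset.sum_congr rfl fun α hα => ?_
  rw [inner_smul_left, hn α hα, RCLike.conj_to_real]

lemma inner_dual_eq_coeff {Φ : Set E} {Δ : Finset E} {coeff : E → E → ℝ} {ϖ : E → E}
    (hcoeff : ∀ β ∈ Φ, β = ∑ α ∈ Δ, coeff β α • α)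
    (hϖ : ∀ α ∈ Δ, ∀ β ∈ Δ, ⟪α, ϖ β⟫ = if α = β then 1 else 0) {α β : E} (hβ : β ∈ Φ)
    (hα : α ∈ Δ) : ⟪β, ϖ α⟫ = coeff β α := by
  conv_lhs => rw [hcoeff β hβ]
  rw [sum_inner]
  have : ∀ γ ∈ Δ, ⟪coeff β γ • γ, ϖ α⟫ = if γ = α then coeff β γ else 0 := by
    intro γ hγ
    rw [inner_smul_left, hϖ γ hγ α hα, RCLike.conj_to_real, mul_ite, mul_one, mul_zero]
  rw [Finset.sum_congr rfl this, Finset.sum_ite_eq', if_pos hα]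

end Folding

theorem folded_coweight_lattice
    {E : Type*} [NormedAddCommGroup E] [InnerProductSpace ℝ E] [FiniteDimensional ℝ E]
    (Φ : Set E) (Δ : Finset E) (coeff : E → E → ℝ) (htilde : E) (ω : E ≃ₗᵢ[ℝ] E)
    (hΦrs : IsRootSystem Φ) (hΦred : IsReducedRS Φ) (hΦirr : IsIrreducibleRS Φ)
    (hΔ : IsBaseRS Φ Δ)
    (hcoeff : ∀ β ∈ Φ, β = ∑ α ∈ Δ, coeff β α • α)
    (hht : htilde ∈ Φ)
    (hhighest : ∀ β ∈ Φ, β ≠ htilde → ∑ α ∈ Δ, coeff β α < ∑ α ∈ Δ, coeff htilde α)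
    (hωW : InWeylGroup Φ ω)
    (hωΔ₀ : ⇑ω '' (↑Δ ∪ {-htilde}) = ↑Δ ∪ {-htilde})
    (ϖ : E → E)
    (hϖdual : ∀ α ∈ Δ, ∀ β ∈ Δ, ⟪α, ϖ β⟫ = if α = β then 1 else 0)
    (hϖ0 : ϖ (-htilde) = 0) :
    {x : E | ω x = x ∧ ∀ v ∈ foldedRoots Φ ω, ∃ n : ℤ, ⟪v, x⟫ = (n : ℝ)} =
      ↑(Submodule.span ℤ {v : E | ∃ α ∈ (↑Δ ∪ {-htilde} : Set E),
        -htilde ∉ orbitOf ω α ∧ v = pibar ω ϖ (orbitOf ω α)}) := by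
  set a : E := -htilde with ha
  set D : Finset E := insert a Δ with hD
  have hDcoe : (↑Δ ∪ {a} : Set E) = ↑D := by simp [hD]
  rw [hDcoe] at hωΔ₀ ⊢
  have haΦ : a ∈ Φ := hΦrs.neg_mem hht
  have hDΦ : (D : Set E) ⊆ Φ := by
    rw [← hDcoe]
    exact Set.union_subset hΔ.1 (Set.singleton_subset_iff.2 haΦ)
  have hht_eq : ∀ β ∈ Φ, ⟪β, ∑ α ∈ Δ, ϖ α⟫ = ∑ α ∈ Δ, coeff β α := fun β hβ => by
    rw [inner_sum]
    exact Finset.sum_congr rfl fun α hα => inner_dual_eq_coeff hcoeff hϖdual hβ hα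
  have hle : ∀ β ∈ Φ, ⟪β, ∑ α ∈ Δ, ϖ α⟫ ≤ ⟪htilde, ∑ α ∈ Δ, ϖ α⟫ := by
    intro β hβ
    by_cases h : β = htilde
    · rw [h]
    · rw [hht_eq β hβ, hht_eq _ hht]
      exact (hhighest β hβ h).le
  have hpos : 0 < ⟪htilde, ∑ α ∈ Δ, ϖ α⟫ := by
    have hne : a ≠ htilde := fun h => by
      have h2 : (2 : ℝ) • htilde = 0 := by rw [two_smul, ← neg_eq_iff_add_eq_zero, ← ha, h]
      exact hΦrs.ne_zero hht ((smul_eq_zero.1 h2).resolve_left two_ne_zero)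
    have h1 := hhighest a haΦ hne
    rw [← hht_eq a haΦ, ← hht_eq _ hht, ha, inner_neg_left] at h1
    linarith
  have haΔ : a ∉ Δ := by
    intro h
    have h1 : ⟪a, ∑ α ∈ Δ, ϖ α⟫ = 1 := by
      rw [inner_sum, Finset.sum_congr rfl fun α hα => hϖdual a h α hα]
      simp [h]
    rw [ha, inner_neg_left] at h1
    linarith
  set m : E → ℝ := fun γ => (if γ = a then 1 else 0) - ⟪a, ϖ γ⟫ with hm
  have hma : m a = 1 := by simp [hm, hϖ0]
  have hmΔ : ∀ γ ∈ Δ, m γ = ⟪htilde, ϖ γ⟫ := by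
    intro γ hγ
    have hne : γ ≠ a := fun h => haΔ (h ▸ hγ)
    simp only [hm, if_neg hne, zero_sub]
    rw [ha, inner_neg_left, neg_neg]
  have hsumm : ∑ γ ∈ D, m γ = 1 + ⟪htilde, ∑ α ∈ Δ, ϖ α⟫ := by
    rw [hD, Finset.sum_insert haΔ, hma, Finset.sum_congr rfl hmΔ, inner_sum]
  have hsumϖ : ∑ γ ∈ D, ϖ γ = ∑ γ ∈ Δ, ϖ γ := by
    rw [hD, Finset.sum_insert haΔ, hϖ0, zero_add]
  have hext : IsExtendedDual D a ϖ m := by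
    refine ⟨Finset.mem_insert_self a Δ, ?_, ?_, ?_, by rw [hsumm]; linarith⟩
    · intro β hβ γ hγ
      rcases Finset.mem_insert.1 hβ with rfl | hβ
      · simp [hm, eq_comm]
      have hβa : β ≠ a := fun h => haΔ (h ▸ hβ)
      rcases Finset.mem_insert.1 hγ with rfl | hγ
      · simp [hϖ0, hβa]
      · simp [hϖdual β hβ γ hγ, hβa]
    · rw [hD, Finset.sum_insert haΔ, hma, one_smul, ha, neg_add_eq_zero]
      conv_lhs => rw [hcoeff htilde hht]
      refine Finset.sum_congr rfl fun γ hγ => ?_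
      rw [hmΔ γ hγ, inner_dual_eq_coeff hcoeff hϖdual hht hγ]
    · refine top_le_iff.1 ?_
      rw [← hΔ.2.2.1]
      exact Submodule.span_mono (by simp [hD])
  have hP : ∀ γ ∈ D, ϖ γ ∈ coweightLattice Φ := by
    intro γ hγ
    rcases Finset.mem_insert.1 hγ with rfl | hγ
    · rw [hϖ0]
      exact zero_mem _
    · refine hΔ.mem_coweightLattice fun α hα => ?_
      rw [hϖdual α hα γ hγ]
      split_ifs
      exacts [⟨1, by simp⟩, ⟨0, by simp⟩]
  have hωΦ : ω '' Φ = Φ :=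
    ((hΦrs.1.injOn_iff_bijOn_of_mapsTo (hωW.mapsTo hΦrs)).1 ω.injective.injOn).image_eq
  have hheight : ∀ β ∈ Φ, |⟪β, ∑ γ ∈ D, ϖ γ⟫| < ∑ γ ∈ D, m γ := by
    intro β hβ
    have h1 := hle β hβ
    have h2 := hle (-β) (hΦrs.neg_mem hβ)
    rw [inner_neg_left] at h2
    rw [hsumm, hsumϖ, abs_lt]
    constructor <;> linarith
  have hfin := isOfFinOrder_of_image_eq hext.span_eq hωΔ₀
  ext x
  constructor
  · rintro ⟨hx, hxv⟩
    exact hext.mem_span_pibar hωΔ₀ hϖ0 hDΦ hx ((forall_foldedRoots_iff hfin hx).1 hxv)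
  · intro hx
    suffices h : ω x = x ∧ x ∈ coweightLattice Φ from
      ⟨h.1, (forall_foldedRoots_iff hfin h.1).2 h.2⟩
    induction hx using Submodule.span_induction with
    | mem x hx =>
      obtain ⟨α, hα, haα, rfl⟩ := hx
      exact ⟨apply_avg ω _, hΔ.mem_coweightLattice fun β hβ =>
        hext.exists_inner_pibar_eq hωΔ₀ hϖ0 hΦrs hP
          (fun x hx => hωW.sub_mem_corootLattice hΦrs hx) hωΦ hheight haΦ hα haα
          (Finset.mem_insert_of_mem hβ)⟩
    | zero => exact ⟨map_zero _, zero_mem _⟩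
    | add x y _ _ hx hy => exact ⟨by rw [map_add, hx.1, hy.1], add_mem hx.2 hy.2⟩
    | smul n x _ hx => exact ⟨by rw [map_zsmul, hx.1], zsmul_mem hx.2 n⟩
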